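/- Given an unprojection datum (β, α, γ) on chain complexes F = (F_i, φ_i)_{0≤i≤n−2} and G = (G_i, ψ_i)_{0≤i≤n−1} of R-modules, define ℋ to be the chain complex with ℋ_i = F_i ⊕ G_i ⊕ F_{i−1} and differential D_i(f, g, f′) = (φ_i(f) + α_i(g) − γ_i(f′), −ψ_i(g) + β_{i−1}(f′), φ_{i−1}(f′)). Then D_{i−1} ∘ D_i = 0, so ℋ is a chain complex, and if moreover H_i(F) = 0 for all i ≥ 1 and H_i(G) = 0 for all i ≥ 2, then H_i(ℋ) = 0 for all i ≥ 2. -/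

import Mathlib

universe u v

/-- `Fm F i` is `F_{i-1}`, i.e. the zero module for `i = 0` and `F i` at `i+1`. -/
abbrev Fm (F : ℕ → Type v) : ℕ → Type v
  | 0 => PUnit
  | i + 1 => F i

instance Fm.addCommGroup (F : ℕ → Type v) [∀ i, AddCommGroup (F i)] :
    ∀ i, AddCommGroup (Fm F i)
  | 0 => inferInstanceAs (AddCommGroup PUnit)
  | i + 1 => inferInstanceAs (AddCommGroup (F i))

instance Fm.module (R : Type u) [Ring R] (F : ℕ → Type v) [∀ i, AddCommGroup (F i)]
    [∀ i, Module R (F i)] : ∀ i, Module R (Fm F i)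
  | 0 => (inferInstance : Module R PUnit.{v + 1})
  | i + 1 => inferInstanceAs (Module R (F i))

section

variable {R : Type u} [Ring R] (F G : ℕ → Type v)
  [∀ i, AddCommGroup (F i)] [∀ i, Module R (F i)]
  [∀ i, AddCommGroup (G i)] [∀ i, Module R (G i)]

/-- `philow i : F i → F (i-1)` is the map `φ_i` of the paper (zero for `i = 0`),
built from `φ i = φ_{i+1} : F (i+1) → F i`. -/
def philow (φ : ∀ i, F (i + 1) →ₗ[R] F i) : ∀ i, F i →ₗ[R] Fm F i
  | 0 => 0
  | i + 1 => φ i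

/-- The complex `ℋ`: `ℋ_i = F_i ⊕ G_i ⊕ F_{i−1}` with differential
`D_i(f, g, f′) = (φ_i f + α_i g − γ_i f′, −ψ_i g + β_{i−1} f′, φ_{i−1} f′)`.
Here `Hd i : ℋ_{i+1} → ℋ_i`, using the convention `φ i = φ_{i+1}`, `ψ i = ψ_{i+1}`,
`α i = α_{i+1}`, `γ i = γ_{i+1}`, `β i = β_i`. -/
def Hd (φ : ∀ i, F (i + 1) →ₗ[R] F i) (ψ : ∀ i, G (i + 1) →ₗ[R] G i)
    (α : ∀ i, G (i + 1) →ₗ[R] F i) (β : ∀ i, F i →ₗ[R] G i)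
    (γ : ∀ i, F i →ₗ[R] F i) (i : ℕ) :
    (F (i + 1) × G (i + 1) × F i) →ₗ[R] (F i × G i × Fm F i) :=
  LinearMap.prod
    (φ i ∘ₗ LinearMap.fst R (F (i + 1)) (G (i + 1) × F i)
      + α i ∘ₗ LinearMap.fst R (G (i + 1)) (F i) ∘ₗ
          LinearMap.snd R (F (i + 1)) (G (i + 1) × F i)
      - γ i ∘ₗ LinearMap.snd R (G (i + 1)) (F i) ∘ₗ
          LinearMap.snd R (F (i + 1)) (G (i + 1) × F i))
    (LinearMap.prod
      (-(ψ i) ∘ₗ LinearMap.fst R (G (i + 1)) (F i) ∘ₗ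
          LinearMap.snd R (F (i + 1)) (G (i + 1) × F i)
        + β i ∘ₗ LinearMap.snd R (G (i + 1)) (F i) ∘ₗ
            LinearMap.snd R (F (i + 1)) (G (i + 1) × F i))
      (philow F φ i ∘ₗ LinearMap.snd R (G (i + 1)) (F i) ∘ₗ
          LinearMap.snd R (F (i + 1)) (G (i + 1) × F i)))

end

/-- The value of the differential of `ℋ` on a triple. -/
lemma Hd_apply {R : Type u} [Ring R] (F G : ℕ → Type v)
    [∀ i, AddCommGroup (F i)] [∀ i, Module R (F i)]
    [∀ i, AddCommGroup (G i)] [∀ i, Module R (G i)]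
    (φ : ∀ i, F (i + 1) →ₗ[R] F i) (ψ : ∀ i, G (i + 1) →ₗ[R] G i)
    (α : ∀ i, G (i + 1) →ₗ[R] F i) (β : ∀ i, F i →ₗ[R] G i)
    (γ : ∀ i, F i →ₗ[R] F i) (i : ℕ) (f : F (i + 1)) (g : G (i + 1)) (e : F i) :
    Hd F G φ ψ α β γ i (f, g, e) =
      (φ i f + α i g - γ i e, -ψ i g + β i e, philow F φ i e) :=
  rfl

/-- `philow` composed with the next differential of `F` vanishes. -/
lemma philow_apply_apply {R : Type u} [Ring R] (F : ℕ → Type v)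
    [∀ i, AddCommGroup (F i)] [∀ i, Module R (F i)]
    (φ : ∀ i, F (i + 1) →ₗ[R] F i) (hφ : ∀ i, φ i ∘ₗ φ (i + 1) = 0) :
    ∀ i (x : F (i + 1)), philow F φ i (φ i x) = 0
  | 0, _ => rfl
  | i + 1, x => LinearMap.congr_fun (hφ i) x

/-- Given an unprojection datum `(β, α, γ)` on chain complexes
`F = (F_i, φ_i)_{0≤i≤n−2}` and `G = (G_i, ψ_i)_{0≤i≤n−1}`, the maps
`D_i(f, g, f′) = (φ_i f + α_i g − γ_i f′, −ψ_i g + β_{i−1} f′, φ_{i−1} f′)` on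
`ℋ_i = F_i ⊕ G_i ⊕ F_{i−1}` satisfy `D_{i−1} ∘ D_i = 0`, so `ℋ` is a chain complex;
and if moreover `H_i(F) = 0` for `i ≥ 1` and `H_i(G) = 0` for `i ≥ 2`, then
`H_i(ℋ) = 0` for all `i ≥ 2`. -/
theorem stmt_4 {R : Type u} [Ring R] {n : ℕ}
    (F G : ℕ → Type u)
    [∀ i, AddCommGroup (F i)] [∀ i, Module R (F i)]
    [∀ i, AddCommGroup (G i)] [∀ i, Module R (G i)]
    (φ : ∀ i, F (i + 1) →ₗ[R] F i) (ψ : ∀ i, G (i + 1) →ₗ[R] G i)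
    (hφ : ∀ i, φ i ∘ₗ φ (i + 1) = 0) (hψ : ∀ i, ψ i ∘ₗ ψ (i + 1) = 0)
    (hFbd : ∀ i, n - 2 < i → ∀ x : F i, x = 0)
    (hGbd : ∀ i, n - 1 < i → ∀ x : G i, x = 0)
    (β : ∀ i, F i →ₗ[R] G i)
    (hβ : ∀ i, ψ i ∘ₗ β (i + 1) = β i ∘ₗ φ i)
    (α : ∀ i, G (i + 1) →ₗ[R] F i)
    (hα : ∀ i, φ i ∘ₗ α (i + 1) = α i ∘ₗ ψ (i + 1))
    (γ : ∀ i, F i →ₗ[R] F i)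
    (hγ0 : γ 0 = 0)
    (hγ : ∀ i, α i ∘ₗ β (i + 1) = φ i ∘ₗ γ (i + 1) + γ i ∘ₗ φ i) :
    -- `ℋ` is a chain complex:
    (∀ i, Hd F G φ ψ α β γ i ∘ₗ Hd F G φ ψ α β γ (i + 1) = 0) ∧
    -- and it is exact in degrees `≥ 2` provided `H_i(F) = 0` for `i ≥ 1`
    -- and `H_i(G) = 0` for `i ≥ 2`:
    ((∀ i (x : F (i + 1)), φ i x = 0 → ∃ y : F (i + 2), φ (i + 1) y = x) →
     (∀ i (x : G (i + 2)), ψ (i + 1) x = 0 → ∃ y : G (i + 3), ψ (i + 2) y = x) →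
     ∀ i (x : F (i + 2) × G (i + 2) × F (i + 1)), Hd F G φ ψ α β γ (i + 1) x = 0 →
       ∃ y : F (i + 3) × G (i + 3) × F (i + 2), Hd F G φ ψ α β γ (i + 2) y = x) := by
  have hφ' : ∀ i x, φ i (φ (i + 1) x) = 0 := fun i => LinearMap.congr_fun (hφ i)
  have hψ' : ∀ i x, ψ i (ψ (i + 1) x) = 0 := fun i => LinearMap.congr_fun (hψ i)
  have hβ' : ∀ i x, ψ i (β (i + 1) x) = β i (φ i x) := fun i => LinearMap.congr_fun (hβ i)
  have hα' : ∀ i x, φ i (α (i + 1) x) = α i (ψ (i + 1) x) :=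
    fun i => LinearMap.congr_fun (hα i)
  have hγ' : ∀ i x, α i (β (i + 1) x) = φ i (γ (i + 1) x) + γ i (φ i x) :=
    fun i => LinearMap.congr_fun (hγ i)
  refine ⟨fun i => LinearMap.ext ?_, fun hF hG i => ?_⟩
  · rintro ⟨f, g, f'⟩
    change Hd F G φ ψ α β γ i (φ (i + 1) f + α (i + 1) g - γ (i + 1) f',
      -ψ (i + 1) g + β (i + 1) f', φ i f') = 0
    rw [Hd_apply]
    refine Prod.ext ?_ (Prod.ext ?_ (philow_apply_apply F φ hφ i f'))
    · simp only [map_add, map_sub, map_neg, hφ', hα', hγ', Prod.fst_zero]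
      abel
    · simp [hψ', hβ']
  · rintro ⟨f, g, f'⟩ hx
    rw [Hd_apply] at hx
    have hf : φ (i + 1) f + α (i + 1) g - γ (i + 1) f' = 0 := congrArg Prod.fst hx
    have hg : -ψ (i + 1) g + β (i + 1) f' = 0 := congrArg (fun p => p.2.1) hx
    have hf' : φ i f' = 0 := congrArg (fun p => p.2.2) hx
    obtain ⟨k, rfl⟩ := hF i f' hf'
    obtain ⟨h, hh⟩ := hG i (β (i + 2) k - g) (by
      rw [map_sub, hβ', ← hg]
      abel)
    obtain ⟨l, hl⟩ := hF (i + 1) (f - α (i + 2) h + γ (i + 2) k) (by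
      rw [map_add, map_sub, hα', hh, map_sub, hγ', ← hf]
      abel)
    refine ⟨(l, h, k), ?_⟩
    rw [Hd_apply, hl, hh]
    refine Prod.ext ?_ (Prod.ext ?_ rfl)
    · dsimp only
      abel
    · dsimp only
      abel
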